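/- Let A be an essentially small hereditary abelian category, linear over a finite field F_q, with finite-dimensional Hom and Ext spaces. For any objects A, B of A (viewed as stalk complexes with zero differential), there are isomorphisms Ext¹_{C₁(A)}(A,B) ≅ Hom_{D₁(A)}(A,B) ≅ Hom_A(A,B) ⊕ Ext¹_A(A,B), where C₁(A) is the category of 1-periodic complexes over A and D₁(A) is the 1-periodic derived category. -/

import Mathlib

/-!
Formalization of statements from "ıquantum groups of split type via derived Hall algebras"
(Chen–Lu–Ruan).  We set up 1-periodic complexes, the 1-periodic derived category,
derived Hall algebras and ıHall algebras.
-/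

open CategoryTheory Limits

noncomputable section

universe w w' w'' v u

/-- The type of isomorphism classes of objects of a category. -/
abbrev IsoCls (C : Type u) [Category.{v} C] : Type u :=
  Quotient (CategoryTheory.isIsomorphicSetoid C)

/-- The isomorphism class `[X]` of an object `X`. -/
abbrev mkIso {C : Type u} [Category.{v} C] (X : C) : IsoCls C :=
  Quotient.mk (CategoryTheory.isIsomorphicSetoid C) X

/-- The complex shape whose homological complexes are the `1`-periodic complexes
`(X, d)` with `d : X ⟶ X`, `d ∘ d = 0`. -/
def oneShape : ComplexShape Unit where
  Rel _ _ := True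
  next_eq _ _ := rfl
  prev_eq _ _ := rfl

/-- The category `C₁(A)` of `1`-periodic complexes over `A`. -/
abbrev OnePeriodic (A : Type u) [Category.{v} A] [Abelian A] := HomologicalComplex A oneShape

section OnePeriodicDefs

variable {A : Type u} [Category.{v} A] [Abelian A]

/-- The stalk complex `C_X = (X, 0)`. -/
def stalkC (X : A) : OnePeriodic A where
  X _ := X
  d _ _ := 0
  shape _ _ h := absurd trivial h
  d_comp_d' := by intros; simp

/-- The morphism of stalk complexes induced by a morphism of `A`. -/
def stalkHom {X Y : A} (f : X ⟶ Y) : stalkC X ⟶ stalkC Y where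
  f _ := f
  comm' := by intros; simp [stalkC]

/-- The acyclic complex `K_X = (X ⊕ X, (0 1 // 0 0))`. -/
def KC (X : A) : OnePeriodic A where
  X _ := X ⊞ X
  d _ _ := biprod.snd ≫ biprod.inl
  shape _ _ h := absurd trivial h
  d_comp_d' := by intros; simp

/-- A `1`-periodic complex is acyclic if `ker d = Im d`, i.e. if it is exact. -/
def IsAcyclic (K : OnePeriodic A) : Prop := ∀ i, K.ExactAt i

/-- The cohomology `H(X•) = ker d / Im d` of a `1`-periodic complex. -/
abbrev cohomology (M : OnePeriodic A) : A := M.homology ()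

/-- The underlying object `res(M•)` of a `1`-periodic complex (restriction functor,
forgetting the differential). -/
abbrev resOP (M : OnePeriodic A) : A := M.X ()

/-- The image `Im d` of the differential of a `1`-periodic complex. -/
def imd (M : OnePeriodic A) : A := Limits.image (M.d () ())

/-- The mapping cone of a morphism of `1`-periodic complexes:
`Y ⊕ X` with differential `(d_Y g // 0 -d_X)`. -/
def cone1 {X Y : OnePeriodic A} (g : X ⟶ Y) : OnePeriodic A where
  X _ := Y.X () ⊞ X.X ()
  d _ _ := biprod.desc (Y.d () () ≫ biprod.inl) (g.f () ≫ biprod.inl - X.d () () ≫ biprod.inr)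
  shape _ _ h := absurd trivial h
  d_comp_d' := by
    intros
    apply biprod.hom_ext'
    · rw [biprod.inl_desc_assoc, Category.assoc, biprod.inl_desc, ← Category.assoc,
        HomologicalComplex.d_comp_d, zero_comp, comp_zero]
    · rw [biprod.inr_desc_assoc, Preadditive.sub_comp, Category.assoc, Category.assoc,
        biprod.inl_desc, biprod.inr_desc, comp_zero, ← Category.assoc,
        HomologicalComplex.Hom.comm, Category.assoc, Preadditive.comp_sub, ← Category.assoc,
        ← Category.assoc, HomologicalComplex.d_comp_d, zero_comp, sub_zero, sub_self]

end OnePeriodicDefs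

section DerivedCategoryOne

variable {A : Type u} [Category.{v} A] [Abelian A]
  [MorphismProperty.HasLocalization.{w'} (HomologicalComplex.quasiIso A oneShape)]

/-- The `1`-periodic derived category `D₁(A)`: the localization of (the homotopy category of)
`C₁(A)` at the quasi-isomorphisms. -/
abbrev DOne (A : Type u) [Category.{v} A] [Abelian A]
    [MorphismProperty.HasLocalization.{w'} (HomologicalComplex.quasiIso A oneShape)] :=
  HomologicalComplexUpToQuasiIso A oneShape

/-- The localization functor `C₁(A) ⥤ D₁(A)`. -/
abbrev QD : OnePeriodic A ⥤ DOne A := HomologicalComplexUpToQuasiIso.Q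

/-- The number of morphisms `A ⟶ B` in `D₁(A)` (for stalk complexes). -/
def homD1Card (X Y : A) : ℕ := Nat.card (QD.obj (stalkC X) ⟶ QD.obj (stalkC Y))

/-- `ã_X`, the number of automorphisms of `X` in `D₁(A)`. -/
def autD1 (X : A) : ℕ := Nat.card (Aut (QD.obj (stalkC X)))

/-- `{X,Y} = 1 / |Hom_{D₁(A)}(X,Y)|`. -/
def braceD (X Y : A) : ℝ := ((homD1Card X Y : ℝ))⁻¹

/-- `M` is a cone of the morphism `f : X ⟶ Y` of `D₁(A)`: writing `f` as a right fraction
`Q(s)⁻¹ ≫ Q(g)` with `s` a quasi-isomorphism of `1`-periodic complexes, the mapping cone of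
`g` is isomorphic to `M` in `D₁(A)`. -/
def IsConeOf {X Y : A} (f : QD.obj (stalkC X) ⟶ QD.obj (stalkC Y)) (M : A) : Prop :=
  ∃ (Z : OnePeriodic A) (s : Z ⟶ stalkC X) (g : Z ⟶ stalkC Y),
    HomologicalComplex.quasiIso A oneShape s ∧ QD.map s ≫ f = QD.map g ∧
      Nonempty (QD.obj (cone1 g) ≅ QD.obj (stalkC M))

/-- `|(X,Y)_M|`, the number of morphisms `f ∈ Hom_{D₁(A)}(X,Y)` with cone isomorphic
to `M`. -/
def coneCount (X Y M : A) : ℕ :=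
  Nat.card {f : QD.obj (stalkC X) ⟶ QD.obj (stalkC Y) // IsConeOf f M}

/-- The derived Hall number `G_{XY}^M`, given by the derived Riedtmann–Peng formula
`G_{XY}^M = (ã_M |(X,Y)_M| / (ã_X ã_Y)) √({X,Y}{M,M}/({X,X}{Y,Y}))`. -/
def Gnum (X Y M : A) : ℝ :=
  ((autD1 M : ℝ) * (coneCount X Y M : ℝ)) / ((autD1 X : ℝ) * (autD1 Y : ℝ)) *
    Real.sqrt ((braceD X Y * braceD M M) / (braceD X X * braceD Y Y))

end DerivedCategoryOne

section Effaceability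

open Abelian

variable {C : Type u} [Category.{v} C] [Abelian C]

/-- The short exact sequence `0 ⟶ ker p ⟶ P ⟶ X ⟶ 0` given by an epimorphism `p : P ⟶ X`. -/
abbrev kernelSequence {P X : C} (p : P ⟶ X) : ShortComplex C :=
  ShortComplex.mk (kernel.ι p) p (kernel.condition p)

lemma kernelSequence_shortExact {P X : C} (p : P ⟶ X) [Epi p] :
    (kernelSequence p).ShortExact :=
  { exact := ShortComplex.exact_kernel p }

lemma extClass_comp_mk₀_kernel_ι_comp [HasExt.{w} C] {P X Y : C} (p : P ⟶ X) [Epi p] (h : P ⟶ Y) :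
    (kernelSequence_shortExact p).extClass.comp (Ext.mk₀ (kernel.ι p ≫ h)) (add_zero 1) = 0 := by
  rw [← Ext.mk₀_comp_mk₀, ← Ext.comp_assoc_of_second_deg_zero]
  exact (congrArg (Ext.comp · _ (add_zero 1)) (kernelSequence_shortExact p).extClass_comp).trans
    (Ext.zero_comp _ _ _ _ _)

/-- Classes in `Ext¹` are effaceable: they are killed by the pullback along some epimorphism. -/
lemma exists_epi_mk₀_comp_eq_zero [HasExt.{w} C] {X Y : C} (η : Ext.{w} X Y 1) :
    ∃ (P : C) (p : P ⟶ X) (_ : Epi p), (Ext.mk₀ p).comp η (zero_add 1) = 0 := by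
  let := HasDerivedCategory.standard C
  let K : CochainComplex C ℤ := (HomologicalComplex.single C (ComplexShape.up ℤ) 0).obj X
  let L : CochainComplex C ℤ := ((CochainComplex.singleFunctor C 0).obj Y)⟦(1 : ℤ)⟧
  let e := (DerivedCategory.Q.commShiftIso (1 : ℤ)).app ((CochainComplex.singleFunctor C 0).obj Y)
  let f : DerivedCategory.Q.obj K ⟶ DerivedCategory.Q.obj L := η.hom ≫ e.inv
  have : K.IsStrictlyLE 0 := by dsimp only [K]; infer_instance
  have hL : L.IsStrictlyLE (-1) :=
    CochainComplex.isStrictlyLE_shift ((CochainComplex.singleFunctor C 0).obj Y) 0 1 (-1) (by lia)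
  obtain ⟨K', _, s, hs, g, hf⟩ := DerivedCategory.right_fac_of_isStrictlyLE f 0
  have hs' : QuasiIso s := (DerivedCategory.isIso_Q_map_iff_quasiIso C s).1 hs
  let p : K'.X 0 ⟶ X := s.f 0 ≫ (HomologicalComplex.singleObjXSelf _ 0 X).hom
  have hd : K'.d 0 1 = 0 := (K'.isZero_of_isStrictlyLE 0 1 (by lia)).eq_of_tgt _ _
  have hK : K.d (-1) 0 = 0 := HomologicalComplex.single_obj_d _ _ _ _ _
  have hK' : K.d 0 1 = 0 := HomologicalComplex.single_obj_d _ _ _ _ _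
  have hs0 : Epi (s.f 0) := by
    have hs'' : Epi (HomologicalComplex.homologyMap s 0) := inferInstance
    rw [HomologicalComplex.epi_homologyMap_iff_up_to_refinements s (-1) 0 1
      (by simp) (by simp)] at hs''
    rw [epi_iff_surjective_up_to_refinements]
    intro T y
    obtain ⟨T', π, hπ, x, -, z, hx⟩ := hs'' y (by rw [hK', comp_zero])
    exact ⟨T', π, hπ, x, by rw [hx, hK, comp_zero, add_zero]⟩
  have hp : Epi p := inferInstance
  let ι : (HomologicalComplex.single C (ComplexShape.up ℤ) 0).obj (K'.X 0) ⟶ K' :=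
    HomologicalComplex.mkHomFromSingle (𝟙 _) (fun k hk ↦ by
      obtain rfl : k = 1 := by simpa using hk.symm
      rw [hd, comp_zero])
  have hι : ι ≫ s = (HomologicalComplex.single C (ComplexShape.up ℤ) 0).map p := by
    apply HomologicalComplex.from_single_hom_ext
    simp [ι, p, HomologicalComplex.single_map_f_self]
  have hg : ι ≫ g = 0 := by
    apply HomologicalComplex.from_single_hom_ext
    exact (L.isZero_of_isStrictlyLE (-1) 0 (by lia)).eq_of_tgt _ _
  refine ⟨K'.X 0, p, hp, ?_⟩
  apply Ext.ext
  rw [← Ext.singleFunctor_map_comp_hom, Ext.zero_hom]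
  have h₁ : η.hom = f ≫ e.hom := (Iso.comp_inv_eq e).1 rfl
  have h₂ : DerivedCategory.Q.map (ι ≫ s) ≫ f = 0 := by
    rw [hf, Functor.map_comp, Category.assoc, IsIso.hom_inv_id_assoc, ← Functor.map_comp, hg,
      Functor.map_zero]
  have h₃ : (DerivedCategory.singleFunctor C 0).map p = DerivedCategory.Q.map (ι ≫ s) := by
    rw [hι]; rfl
  rw [h₁, h₃]
  exact (Category.assoc _ _ _).symm.trans ((congrArg (· ≫ e.hom) h₂).trans zero_comp)

/-- The map on kernels induced by `f : P' ⟶ P` over `X`. -/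
abbrev kernelMap {P P' X : C} {p : P ⟶ X} {p' : P' ⟶ X} (f : P' ⟶ P) (hf : f ≫ p = p') :
    kernel p' ⟶ kernel p :=
  kernel.lift p (kernel.ι p' ≫ f) (by rw [Category.assoc, hf, kernel.condition])

lemma extClass_kernelMap [HasExt.{w} C] {P P' X : C} {p : P ⟶ X} {p' : P' ⟶ X} [Epi p] [Epi p']
    (f : P' ⟶ P) (hf : f ≫ p = p') :
    (kernelSequence_shortExact p').extClass.comp (Ext.mk₀ (kernelMap f hf)) (add_zero 1) =
      (kernelSequence_shortExact p).extClass := by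
  let φ : kernelSequence p' ⟶ kernelSequence p :=
    { τ₁ := kernelMap f hf
      τ₂ := f
      τ₃ := 𝟙 X
      comm₁₂ := by simp
      comm₂₃ := by simp [hf] }
  have := ShortComplex.ShortExact.extClass_naturality
    (kernelSequence_shortExact p') (kernelSequence_shortExact p) φ
  simpa [φ] using this

/-- In a hereditary category, an epimorphism onto the kernel of `p : P ⟶ X` can be split
after refining `P`. -/
lemma exists_refinement_lift [HasExt.{w} C]
    (hHered : ∀ X Y : C, Subsingleton (Ext.{w} X Y 2))
    {P X B : C} (p : P ⟶ X) [Epi p] (q : B ⟶ kernel p) [Epi q] :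
    ∃ (P' : C) (r : P' ⟶ P) (_ : Epi r) (l : kernel (r ≫ p) ⟶ B),
      l ≫ q = kernelMap r rfl := by
  obtain ⟨η, hη⟩ := Ext.contravariant_sequence_exact₁ (kernelSequence_shortExact p) _
    (kernelSequence_shortExact q).extClass (n₁ := 2) rfl
    ((hHered _ _).elim _ _)
  obtain ⟨P', r, hr, h⟩ := exists_epi_mk₀_comp_eq_zero η
  refine ⟨P', r, hr, ?_⟩
  have h₀ : (Ext.mk₀ (kernelMap r (rfl : r ≫ p = _))).comp
      (kernelSequence_shortExact q).extClass (zero_add 1) = 0 := by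
    rw [← hη, Ext.mk₀_comp_mk₀_assoc, kernel.lift_ι, ← Ext.mk₀_comp_mk₀_assoc, h, Ext.comp_zero]
  obtain ⟨l, hl⟩ := Ext.covariant_sequence_exact₃ _ (kernelSequence_shortExact q) _ _ h₀
  obtain ⟨l, rfl⟩ := (Ext.mk₀_bijective _ _).2 l
  refine ⟨l, ?_⟩
  rw [Ext.mk₀_comp_mk₀] at hl
  exact (Ext.mk₀_bijective _ _).1 hl

end Effaceability

section KernelMap

variable {C : Type u} [Category.{v} C] [Abelian C]

lemma kernelMap_ι {P P' X : C} {p : P ⟶ X} {p' : P' ⟶ X} (f : P' ⟶ P) (hf : f ≫ p = p') :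
    kernelMap f hf ≫ kernel.ι p = kernel.ι p' ≫ f :=
  kernel.lift_ι _ _ _

lemma kernelMap_ι_assoc {P P' X Z : C} {p : P ⟶ X} {p' : P' ⟶ X} (f : P' ⟶ P)
    (hf : f ≫ p = p') (h : P ⟶ Z) :
    kernelMap f hf ≫ kernel.ι p ≫ h = kernel.ι p' ≫ f ≫ h := by
  rw [← Category.assoc, kernelMap_ι, Category.assoc]

lemma kernelMap_comp {P P' P'' X : C} {p : P ⟶ X} {p' : P' ⟶ X} {p'' : P'' ⟶ X}
    (g : P'' ⟶ P') (hg : g ≫ p' = p'') (f : P' ⟶ P) (hf : f ≫ p = p') :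
    kernelMap g hg ≫ kernelMap f hf =
      kernelMap (g ≫ f) (by rw [Category.assoc, hf, hg]) := by
  rw [← cancel_mono (kernel.ι p), Category.assoc, kernelMap_ι, kernelMap_ι_assoc, kernelMap_ι]

lemma kernelMap_id_comp {P X Z : C} (p : P ⟶ X) (b : kernel p ⟶ Z) :
    kernelMap (𝟙 P) (Category.id_comp p) ≫ b = b := by
  have : kernelMap (𝟙 P) (Category.id_comp p) = 𝟙 _ := by
    rw [← cancel_mono (kernel.ι p), kernelMap_ι, Category.comp_id, Category.id_comp]
  rw [this, Category.id_comp]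

/-- Two lifts of the same map to `X` differ by a map to the kernel. -/
lemma exists_kernel_lift_sub {P P' X : C} {p : P ⟶ X} {p' : P' ⟶ X} (f g : P' ⟶ P)
    (hf : f ≫ p = p') (hg : g ≫ p = p') :
    ∃ m : P' ⟶ kernel p, f = g + m ≫ kernel.ι p ∧
      kernelMap f hf = kernelMap g hg + kernel.ι p' ≫ m := by
  refine ⟨kernel.lift p (f - g) (by rw [Preadditive.sub_comp, hf, hg, sub_self]), by simp, ?_⟩
  rw [← cancel_mono (kernel.ι p)]
  simp

end KernelMap

section Refinements

variable {A : Type u} [Category.{v} A] [Abelian A]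

lemma OnePeriodic.quasiIso_iff_up_to_refinements {M N : OnePeriodic A} (s : M ⟶ N) :
    HomologicalComplex.quasiIso A oneShape s ↔
      (∀ ⦃T : A⦄ (x : T ⟶ M.X ()) (_ : x ≫ M.d () () = 0) (y : T ⟶ N.X ())
        (_ : x ≫ s.f () = y ≫ N.d () ()),
        ∃ (T' : A) (π : T' ⟶ T) (_ : Epi π) (x' : T' ⟶ M.X ()), π ≫ x = x' ≫ M.d () ()) ∧
      (∀ ⦃T : A⦄ (y : T ⟶ N.X ()) (_ : y ≫ N.d () () = 0),
        ∃ (T' : A) (π : T' ⟶ T) (_ : Epi π) (x : T' ⟶ M.X ()) (_ : x ≫ M.d () () = 0)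
          (y' : T' ⟶ N.X ()), π ≫ y = x ≫ s.f () + y' ≫ N.d () ()) := by
  rw [← HomologicalComplex.mono_homologyMap_iff_up_to_refinements s () () () rfl rfl,
    ← HomologicalComplex.epi_homologyMap_iff_up_to_refinements s () () () rfl rfl,
    HomologicalComplex.mem_quasiIso_iff, quasiIso_iff]
  constructor
  · intro h
    have := (quasiIsoAt_iff_isIso_homologyMap s ()).1 (h ())
    exact ⟨inferInstance, inferInstance⟩
  · rintro ⟨_, _⟩ ⟨⟩
    rw [quasiIsoAt_iff_isIso_homologyMap]
    exact isIso_of_mono_of_epi _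

end Refinements

section ResolvedMap

variable {A : Type u} [Category.{v} A] [Abelian A]

/-- A map in the `1`-periodic derived category from the stalk complex of `X` to `M`,
presented by an epimorphism `p : P ⟶ X` and a map from the complex
`P ⊕ ker p` (with differential the inclusion of `ker p` in `P`) to `M`. -/
structure ResolvedMap (X : A) (M : OnePeriodic A) where
  {P : A}
  (p : P ⟶ X)
  [epi : Epi p]
  (a : P ⟶ M.X ())
  (b : kernel p ⟶ M.X ())
  (ha : a ≫ M.d () () = 0)
  (hb : kernel.ι p ≫ a = b ≫ M.d () ())

namespace ResolvedMap

attribute [instance] epi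

variable {X : A} {M N : OnePeriodic A}

/-- Two resolved maps are equivalent if they become homotopic on a common refinement. -/
def Equiv (D D' : ResolvedMap X M) : Prop :=
  ∃ (R : A) (r : R ⟶ X) (_ : Epi r) (u : R ⟶ D.P) (hu : u ≫ D.p = r)
    (v : R ⟶ D'.P) (hv : v ≫ D'.p = r) (h₀ : R ⟶ M.X ()) (h₁ : kernel r ⟶ M.X ()),
    u ≫ D.a = v ≫ D'.a + h₀ ≫ M.d () () ∧
    kernelMap u hu ≫ D.b = kernelMap v hv ≫ D'.b + kernel.ι r ≫ h₀ + h₁ ≫ M.d () ()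

lemma Equiv.refl (D : ResolvedMap X M) : D.Equiv D :=
  ⟨D.P, D.p, inferInstance, 𝟙 _, by simp, 𝟙 _, by simp, 0, 0, by simp, by simp⟩

lemma Equiv.symm {D D' : ResolvedMap X M} (h : D.Equiv D') : D'.Equiv D := by
  obtain ⟨R, r, hr, u, hu, v, hv, h₀, h₁, e₀, e₁⟩ := h
  refine ⟨R, r, hr, v, hv, u, hu, -h₀, -h₁, ?_, ?_⟩
  · simp [e₀]
  · rw [e₁]
    simp only [Preadditive.comp_neg, Preadditive.neg_comp]
    abel

lemma Equiv.trans {D D' D'' : ResolvedMap X M} (h : D.Equiv D') (h' : D'.Equiv D'') :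
    D.Equiv D'' := by
  obtain ⟨R, r, hr, u, hu, v, hv, h₀, h₁, e₀, e₁⟩ := h
  obtain ⟨S, s, hs, u', hu', v', hv', k₀, k₁, e₀', e₁'⟩ := h'
  let f := pullback.fst r s
  let g := pullback.snd r s
  have hg : g ≫ s = f ≫ r := pullback.condition.symm
  obtain ⟨m, hm, hm'⟩ := exists_kernel_lift_sub (p := D'.p) (p' := f ≫ r) (f ≫ v) (g ≫ u')
    (by simp [hv]) (by rw [Category.assoc, hu', hg])
  refine ⟨_, f ≫ r, inferInstance, f ≫ u, by simp [hu], g ≫ v',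
    by rw [Category.assoc, hv', hg], f ≫ h₀ + m ≫ D'.b + g ≫ k₀,
    kernelMap f rfl ≫ h₁ + kernelMap g hg ≫ k₁, ?_, ?_⟩
  · have := hm =≫ D'.a
    simp only [Category.assoc, Preadditive.add_comp, D'.hb] at this
    simp only [Category.assoc, Preadditive.add_comp, e₀, e₀', Preadditive.comp_add, this]
    abel
  · have := hm' =≫ D'.b
    simp only [← kernelMap_comp f rfl v hv, ← kernelMap_comp g hg u' hu',
      Category.assoc, Preadditive.add_comp, e₁'] at this
    simp only [← kernelMap_comp f rfl u hu, ← kernelMap_comp g hg v' hv', Category.assoc, e₁,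
      Preadditive.comp_add, this, Preadditive.add_comp, kernelMap_ι_assoc]
    abel

variable (X M) in
/-- The setoid of equivalence of resolved maps. -/
def setoid : Setoid (ResolvedMap X M) := ⟨Equiv, Equiv.refl, Equiv.symm, Equiv.trans⟩

variable (X M) in
/-- Equivalence classes of resolved maps. -/
def Cls : Type max u v := Quotient (setoid X M)

/-- The class of a resolved map. -/
def cls (D : ResolvedMap X M) : Cls X M := Quotient.mk (setoid X M) D

lemma cls_eq_iff {D D' : ResolvedMap X M} : D.cls = D'.cls ↔ D.Equiv D' :=
  Quotient.eq (r := setoid X M)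

lemma exists_cls_eq (x : Cls X M) : ∃ D : ResolvedMap X M, D.cls = x :=
  Quotient.exists_rep x

/-- Postcomposition of a resolved map with a morphism of complexes. -/
@[simps]
def postcomp (D : ResolvedMap X M) (f : M ⟶ N) : ResolvedMap X N where
  P := D.P
  p := D.p
  a := D.a ≫ f.f ()
  b := D.b ≫ f.f ()
  ha := by rw [Category.assoc, f.comm, ← Category.assoc, D.ha, zero_comp]
  hb := by rw [Category.assoc, f.comm, ← Category.assoc, D.hb, Category.assoc]

instance (D : ResolvedMap X M) (f : M ⟶ N) : Epi (D.postcomp f).p := D.epi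

lemma Equiv.postcomp {D D' : ResolvedMap X M} (h : D.Equiv D') (f : M ⟶ N) :
    (D.postcomp f).Equiv (D'.postcomp f) := by
  obtain ⟨R, r, hr, u, hu, v, hv, h₀, h₁, e₀, e₁⟩ := h
  refine ⟨R, r, hr, u, hu, v, hv, h₀ ≫ f.f (), h₁ ≫ f.f (), ?_, ?_⟩
  · have := e₀ =≫ f.f ()
    simp only [Preadditive.add_comp, Category.assoc, f.comm] at this ⊢
    exact this
  · have := e₁ =≫ f.f ()
    simp only [Preadditive.add_comp, Category.assoc, f.comm] at this ⊢
    exact this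

variable (X) in
/-- Equivalence classes of resolved maps, as a functor in the target. -/
@[simps]
def functor : OnePeriodic A ⥤ Type max u v where
  obj M := Cls X M
  map f := TypeCat.ofHom (Quotient.map' (s₁ := setoid X _) (s₂ := setoid X _)
    (fun D ↦ D.postcomp f) (fun _ _ h ↦ Equiv.postcomp h f))
  map_id M := by
    ext x
    obtain ⟨D, rfl⟩ := exists_cls_eq x
    refine congrArg cls (?_ : D.postcomp _ = D)
    cases D
    simp [postcomp]
  map_comp f g := by
    ext x
    obtain ⟨D, rfl⟩ := exists_cls_eq x
    refine congrArg cls (?_ : D.postcomp _ = (D.postcomp f).postcomp g)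
    simp [postcomp]

end ResolvedMap

end ResolvedMap

section QuasiIso

variable {A : Type u} [Category.{v} A] [Abelian A]

namespace ResolvedMap

variable {X : A} {M N : OnePeriodic A}

lemma exists_refinement_nullHomotopy [HasExt.{w} A]
    (hHered : ∀ X Y : A, Subsingleton (Abelian.Ext.{w} X Y 2))
    (s : M ⟶ N) (hs : HomologicalComplex.quasiIso A oneShape s)
    {R : A} (r : R ⟶ X) [Epi r] (a : R ⟶ M.X ()) (b : kernel r ⟶ M.X ())
    (ha : a ≫ M.d () () = 0) (hb : kernel.ι r ≫ a = b ≫ M.d () ())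
    (h₀ : R ⟶ N.X ()) (h₁ : kernel r ⟶ N.X ()) (e₀ : a ≫ s.f () = h₀ ≫ N.d () ())
    (e₁ : b ≫ s.f () = kernel.ι r ≫ h₀ + h₁ ≫ N.d () ()) :
    ∃ (R' : A) (r' : R' ⟶ X) (_ : Epi r') (w : R' ⟶ R) (hw : w ≫ r = r')
      (k₀ : R' ⟶ M.X ()) (k₁ : kernel r' ⟶ M.X ()), w ≫ a = k₀ ≫ M.d () () ∧
        kernelMap w hw ≫ b = kernel.ι r' ≫ k₀ + k₁ ≫ M.d () () := by
  obtain ⟨hmono, hepi⟩ := (OnePeriodic.quasiIso_iff_up_to_refinements s).1 hs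
  obtain ⟨P₁, π, _, k₀, hk₀⟩ := hmono a ha h₀ e₀
  obtain ⟨P₂, π₂, _, l₀, hl₀, m, hm⟩ := hepi (π ≫ h₀ - k₀ ≫ s.f ()) (by
    rw [Preadditive.sub_comp, Category.assoc, Category.assoc, s.comm, ← e₀, ← reassoc_of% hk₀,
      sub_self])
  let j := kernel.ι (π₂ ≫ π ≫ r)
  have hm' := j ≫= hm
  let c : kernel (π₂ ≫ π ≫ r) ⟶ kernel r := kernelMap (π₂ ≫ π) (Category.assoc _ _ _)
  have hc : c ≫ kernel.ι r = j ≫ π₂ ≫ π := kernelMap_ι _ _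
  let γ := c ≫ b - j ≫ (π₂ ≫ k₀ + l₀)
  obtain ⟨B, q, _, x, hx⟩ := hmono γ (by
      simp only [γ, Preadditive.sub_comp, Preadditive.add_comp, Category.assoc, hl₀, add_zero,
        ← hb, ← hk₀, reassoc_of% hc, sub_self])
    (j ≫ m + c ≫ h₁) (by
      simp only [Preadditive.comp_add, Preadditive.comp_sub] at hm'
      simp only [γ, Preadditive.sub_comp, Preadditive.add_comp, Preadditive.comp_add,
        Category.assoc, e₁, reassoc_of% hc, eq_sub_of_add_eq' hm'.symm]
      abel)
  obtain ⟨P₃, g, _, l, hl⟩ := exists_refinement_lift hHered (π₂ ≫ π ≫ r) q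
  have hw : (g ≫ π₂ ≫ π) ≫ r = g ≫ π₂ ≫ π ≫ r := by simp only [Category.assoc]
  refine ⟨P₃, g ≫ π₂ ≫ π ≫ r, inferInstance, g ≫ π₂ ≫ π, hw, g ≫ (π₂ ≫ k₀ + l₀), l ≫ x, ?_, ?_⟩
  · simp only [Category.assoc, hk₀, Preadditive.add_comp, hl₀, add_zero]
  · rw [Category.assoc, ← hx, reassoc_of% hl,
      ← kernelMap_comp g rfl (π₂ ≫ π) (Category.assoc _ _ _),
      Category.assoc, Preadditive.comp_sub, kernelMap_ι_assoc, add_sub_cancel]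

lemma postcomp_injective [HasExt.{w} A]
    (hHered : ∀ X Y : A, Subsingleton (Abelian.Ext.{w} X Y 2))
    (s : M ⟶ N) (hs : HomologicalComplex.quasiIso A oneShape s) {D D' : ResolvedMap X M}
    (h : (D.postcomp s).Equiv (D'.postcomp s)) : D.Equiv D' := by
  obtain ⟨R, r, _, (u : R ⟶ D.P), (hu : u ≫ D.p = r), (v : R ⟶ D'.P), (hv : v ≫ D'.p = r),
    h₀, h₁, e₀, e₁⟩ := h
  replace e₀ : u ≫ D.a ≫ s.f () = v ≫ D'.a ≫ s.f () + h₀ ≫ N.d () () := e₀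
  replace e₁ : kernelMap u hu ≫ D.b ≫ s.f () =
    kernelMap v hv ≫ D'.b ≫ s.f () + kernel.ι r ≫ h₀ + h₁ ≫ N.d () () := e₁
  obtain ⟨R', r', hr', w, hw, k₀, k₁, f₀, f₁⟩ := exists_refinement_nullHomotopy hHered s hs r
    (u ≫ D.a - v ≫ D'.a) (kernelMap u hu ≫ D.b - kernelMap v hv ≫ D'.b)
    (by simp only [Preadditive.sub_comp, Category.assoc, D.ha, D'.ha, comp_zero, sub_zero])
    (by simp only [Preadditive.sub_comp, Preadditive.comp_sub, Category.assoc, ← D.hb, ← D'.hb,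
      kernelMap_ι_assoc])
    h₀ h₁ (by simp only [Preadditive.sub_comp, Category.assoc, e₀, add_sub_cancel_left])
    (by
      simp only [Preadditive.sub_comp, Category.assoc, e₁]
      abel)
  refine ⟨R', r', hr', w ≫ u, by rw [Category.assoc, hu, hw], w ≫ v,
    by rw [Category.assoc, hv, hw], k₀, k₁, ?_, ?_⟩
  · rw [← f₀, Preadditive.comp_sub, Category.assoc, Category.assoc, add_sub_cancel]
  · rw [add_assoc, ← f₁, Preadditive.comp_sub, ← kernelMap_comp w hw u hu,
      ← kernelMap_comp w hw v hv, Category.assoc, Category.assoc, add_sub_cancel]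

lemma exists_postcomp_equiv [HasExt.{w} A]
    (hHered : ∀ X Y : A, Subsingleton (Abelian.Ext.{w} X Y 2))
    (s : M ⟶ N) (hs : HomologicalComplex.quasiIso A oneShape s) (D : ResolvedMap X N) :
    ∃ D' : ResolvedMap X M, (D'.postcomp s).Equiv D := by
  obtain ⟨hmono, hepi⟩ := (OnePeriodic.quasiIso_iff_up_to_refinements s).1 hs
  obtain ⟨P₁, π, _, x, hx, y, hy⟩ := hepi D.a D.ha
  let p₁ := π ≫ D.p
  have hy' := kernel.ι p₁ ≫= hy
  rw [← kernelMap_ι_assoc (p := D.p) π rfl, D.hb] at hy'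
  obtain ⟨B, q, _, z, hz⟩ := hmono (kernel.ι p₁ ≫ x) (by rw [Category.assoc, hx, comp_zero])
    (kernelMap π rfl ≫ D.b - kernel.ι p₁ ≫ y) (by
      simp only [Preadditive.comp_add] at hy'
      simp only [Preadditive.sub_comp, Category.assoc, hy', add_sub_cancel_right])
  obtain ⟨P₂, f, _, l, hl⟩ := exists_refinement_lift hHered p₁ q
  obtain ⟨c, hc⟩ : ∃ c : kernel (f ≫ p₁) ⟶ M.X (),
      c ≫ M.d () () = kernel.ι (f ≫ p₁) ≫ f ≫ x :=
    ⟨l ≫ z, by rw [Category.assoc, ← hz, reassoc_of% hl, kernelMap_ι_assoc]⟩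
  let e := kernelMap f (rfl : f ≫ p₁ = _) ≫ kernelMap π rfl ≫ D.b -
    kernel.ι (f ≫ p₁) ≫ f ≫ y - c ≫ s.f ()
  obtain ⟨B', q', _, x', hx', y', hy''⟩ := hepi e (by
    simp only [e, Preadditive.sub_comp, Category.assoc, s.comm, ← D.hb, reassoc_of% hc,
      kernelMap_ι_assoc, hy, Preadditive.comp_add]
    abel)
  obtain ⟨P₃, g, _, l', hl'⟩ := exists_refinement_lift hHered (f ≫ p₁) q'
  have hu : (g ≫ f ≫ π) ≫ D.p = g ≫ f ≫ p₁ := by simp only [p₁, Category.assoc]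
  let D' : ResolvedMap X M :=
    { P := P₃
      p := g ≫ f ≫ p₁
      a := g ≫ f ≫ x
      b := kernelMap g rfl ≫ c + l' ≫ x'
      ha := by simp only [Category.assoc, hx, comp_zero]
      hb := by
        rw [Preadditive.add_comp, Category.assoc, Category.assoc, hx', hc, comp_zero, add_zero,
          kernelMap_ι_assoc] }
  refine ⟨D', Equiv.symm ⟨P₃, g ≫ f ≫ p₁, inferInstance, g ≫ f ≫ π, hu, 𝟙 _,
    Category.id_comp (g ≫ f ≫ p₁), g ≫ f ≫ y, l' ≫ y', ?_, ?_⟩⟩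
  · refine Eq.trans ?_ (congrArg (· + _) (Category.id_comp ((g ≫ f ≫ x) ≫ s.f ())).symm)
    simp only [Category.assoc, hy, Preadditive.comp_add]
  · refine Eq.trans ?_ (congrArg (· + _ + _) (kernelMap_id_comp (g ≫ f ≫ p₁)
      ((kernelMap g rfl ≫ c + l' ≫ x') ≫ s.f ())).symm)
    have h := l' ≫= hy''
    rw [reassoc_of% hl'] at h
    simp only [e, Preadditive.comp_sub, Preadditive.comp_add, kernelMap_ι_assoc] at h
    rw [sub_eq_iff_eq_add, sub_eq_iff_eq_add] at h
    have h' : kernelMap (g ≫ f ≫ π) hu = kernelMap g rfl ≫ kernelMap f rfl ≫ kernelMap π rfl := by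
      rw [kernelMap_comp, kernelMap_comp]
    rw [h', Category.assoc, Category.assoc, h]
    simp only [Preadditive.add_comp, Category.assoc]
    abel

lemma isIso_functor_map [HasExt.{w} A]
    (hHered : ∀ X Y : A, Subsingleton (Abelian.Ext.{w} X Y 2))
    (s : M ⟶ N) (hs : HomologicalComplex.quasiIso A oneShape s) : IsIso ((functor X).map s) := by
  rw [isIso_iff_bijective]
  constructor
  · intro x y h
    obtain ⟨D, rfl⟩ := exists_cls_eq x
    obtain ⟨D', rfl⟩ := exists_cls_eq y
    exact cls_eq_iff.2 (postcomp_injective hHered s hs (cls_eq_iff.1 h))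
  · intro x
    obtain ⟨D, rfl⟩ := exists_cls_eq x
    obtain ⟨D', h⟩ := exists_postcomp_equiv hHered s hs D
    exact ⟨D'.cls, cls_eq_iff.2 h⟩

end ResolvedMap

end QuasiIso

section Localization

variable {C : Type*} [Category* C] {D : Type*} [Category.{w'} D]

/-- A criterion for computing the morphisms in a localized category: if a functor `F` to types
inverts `W` and all its elements come from a fixed element `e` of `F.obj X` through
left fractions, then `F` computes the morphisms from `L.obj X` to objects `L.obj M`. -/
lemma bijective_of_isInvertedBy (L : C ⥤ D) (W : MorphismProperty C) [L.IsLocalization W]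
    (F : C ⥤ Type w) (hF : W.IsInvertedBy F) {X : C} (e : F.obj X)
    (β : ∀ M : C, F.obj M → (L.obj X ⟶ L.obj M))
    (hβ : ∀ ⦃M N : C⦄ (f : M ⟶ N) (x : F.obj M), β N (F.map f x) = β M x ≫ L.map f)
    (he : β X e = 𝟙 _)
    (h : ∀ (M : C) (x : F.obj M), ∃ (Z : C) (z : F.obj Z) (s : Z ⟶ X) (t : Z ⟶ M),
      F.map s z = e ∧ F.map t z = x ∧ L.map s ≫ β M x = L.map t) (M : C) :
    Function.Bijective (β M) := by
  let F' := Localization.lift F hF L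
  let iso : L ⋙ F' ≅ F := Localization.fac F hF L
  have nat {M N : C} (f : M ⟶ N) (x : F.obj M) :
      F'.map (L.map f) (iso.inv.app M x) = iso.inv.app N (F.map f x) :=
    (NatTrans.naturality_apply iso.inv f x).symm
  have hom_inv {M : C} (x : F.obj M) : iso.hom.app M (iso.inv.app M x) = x :=
    types_congr_hom (iso.inv_hom_id_app M) x
  have inv_hom {M : C} (x : F'.obj (L.obj M)) : iso.inv.app M (iso.hom.app M x) = x :=
    types_congr_hom (iso.hom_inv_id_app M) x
  have hα (x : F.obj M) : iso.hom.app M (F'.map (β M x) (iso.inv.app X e)) = x := by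
    obtain ⟨Z, z, s, t, rfl, rfl, hst⟩ := h M x
    have := types_congr_hom ((F'.map_comp _ _).symm.trans (congrArg F'.map hst))
      (iso.inv.app Z z)
    rw [types_comp_apply, nat, nat] at this
    exact (congrArg _ this).trans (hom_inv _)
  constructor
  · intro x y hxy
    rw [← hα x, hxy, hα y]
  · intro g
    let G : D ⥤ Type max w w' := coyoneda.obj (Opposite.op (L.obj X)) ⋙ uliftFunctor.{w, w'}
    let τ : F ⋙ uliftFunctor.{w', w} ⟶ L ⋙ G :=
      { app M := TypeCat.ofHom fun x ↦ ULift.up (β M x.down)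
        naturality M N f := by
          ext x
          exact congrArg ULift.up (hβ f x.down) }
    let τ' : F' ⋙ uliftFunctor.{w', w} ⟶ G := Localization.liftNatTrans L W _ (L ⋙ G) _ _ τ
    let φ (d : D) : ULift.{w'} (F'.obj d) ⟶ ULift.{w} (L.obj X ⟶ d) := τ'.app d
    let γ (d : D) (x : F'.obj d) : L.obj X ⟶ d := (φ d (ULift.up x)).down
    have hγ_nat {d d' : D} (g : d ⟶ d') (x : F'.obj d) : γ d' (F'.map g x) = γ d x ≫ g :=
      congrArg ULift.down (types_congr_hom (τ'.naturality g)
        (ULift.up x : ULift.{w'} (F'.obj d)))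
    have hγ {M : C} (x : F.obj M) : γ (L.obj M) (iso.inv.app M x) = β M x := by
      refine (congrArg ULift.down (types_congr_hom (Localization.liftNatTrans_app L W _ (L ⋙ G)
        (F' ⋙ uliftFunctor.{w', w}) G τ M)
        (ULift.up (iso.inv.app M x)))).trans ?_
      exact congrArg (β M) (hom_inv x)
    refine ⟨iso.hom.app M (F'.map g (iso.inv.app X e)), ?_⟩
    rw [← hγ, inv_hom, hγ_nat, hγ, he, Category.id_comp]

end Localization

section Fold

variable {A : Type u} [Category.{v} A] [Abelian A]

/-- The `1`-periodic complex `P ⊕ ker p` whose differential is the inclusion of `ker p`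
in `P`. -/
def foldC {P X : A} (p : P ⟶ X) : OnePeriodic A where
  X _ := P ⊞ kernel p
  d _ _ := biprod.snd ≫ kernel.ι p ≫ biprod.inl
  shape _ _ h := absurd trivial h
  d_comp_d' := by intros; simp

/-- The augmentation of `foldC p`. -/
def foldAug {P X : A} (p : P ⟶ X) : foldC p ⟶ stalkC X where
  f _ := biprod.fst ≫ p
  comm' := by intros; simp [foldC, stalkC]

/-- Morphisms from `foldC p`. -/
def foldDesc {P X : A} (p : P ⟶ X) {M : OnePeriodic A} (a : P ⟶ M.X ()) (b : kernel p ⟶ M.X ())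
    (ha : a ≫ M.d () () = 0) (hb : kernel.ι p ≫ a = b ≫ M.d () ()) : foldC p ⟶ M where
  f _ := biprod.desc a b
  comm' := by
    intros
    apply biprod.hom_ext' <;> simp [foldC, ha, hb]

/-- The map `foldC p' ⟶ foldC p` induced by `f : P' ⟶ P` over `X`. -/
def foldMap {P P' X : A} {p : P ⟶ X} {p' : P' ⟶ X} (f : P' ⟶ P) (hf : f ≫ p = p') :
    foldC p' ⟶ foldC p where
  f _ := biprod.map f (kernelMap f hf)
  comm' := by
    intros
    apply biprod.hom_ext' <;> simp [foldC]

lemma foldMap_foldAug {P P' X : A} {p : P ⟶ X} {p' : P' ⟶ X} (f : P' ⟶ P) (hf : f ≫ p = p') :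
    foldMap f hf ≫ foldAug p = foldAug p' := by
  ext
  change biprod.map f (kernelMap f hf) ≫ biprod.fst ≫ p = biprod.fst ≫ p'
  rw [biprod.map_fst_assoc, hf]

lemma quasiIso_foldAug {P X : A} (p : P ⟶ X) [Epi p] :
    HomologicalComplex.quasiIso A oneShape (foldAug p) := by
  rw [OnePeriodic.quasiIso_iff_up_to_refinements]
  constructor
  · intro T (x : T ⟶ P ⊞ kernel p) (hx : x ≫ biprod.snd ≫ kernel.ι p ≫ biprod.inl = 0)
      (y : T ⟶ X) (hy : x ≫ biprod.fst ≫ p = y ≫ 0)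
    have hx' : x ≫ biprod.snd = 0 := by
      rw [← cancel_mono (kernel.ι p ≫ biprod.inl (Y := kernel p)), Category.assoc, hx, zero_comp]
    rw [comp_zero, ← Category.assoc] at hy
    refine ⟨T, 𝟙 T, inferInstance, kernel.lift p _ hy ≫ biprod.inr, ?_⟩
    change 𝟙 T ≫ x = (kernel.lift p _ hy ≫ biprod.inr) ≫ biprod.snd ≫ kernel.ι p ≫ biprod.inl
    apply biprod.hom_ext <;> simp [hx']
  · intro T (y : T ⟶ X) hy
    refine ⟨_, pullback.fst y p, inferInstance, pullback.snd y p ≫ biprod.inl, ?_, 0, ?_⟩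
    · change (pullback.snd y p ≫ biprod.inl) ≫ biprod.snd ≫ kernel.ι p ≫ biprod.inl = 0
      simp
    · rw [zero_comp, add_zero]
      change pullback.fst y p ≫ y = (pullback.snd y p ≫ biprod.inl) ≫ biprod.fst ≫ p
      simp [pullback.condition]

/-- Homotopies between morphisms from `foldC p`. -/
def foldHomotopy {P X : A} (p : P ⟶ X) {M : OnePeriodic A} (φ ψ : foldC p ⟶ M)
    (h₀ : P ⟶ M.X ()) (h₁ : kernel p ⟶ M.X ())
    (e₀ : biprod.inl ≫ φ.f () = biprod.inl ≫ ψ.f () + h₀ ≫ M.d () ())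
    (e₁ : biprod.inr ≫ φ.f () = biprod.inr ≫ ψ.f () + kernel.ι p ≫ h₀ + h₁ ≫ M.d () ()) :
    Homotopy φ ψ where
  hom _ _ := biprod.desc h₀ h₁
  zero _ _ h := absurd trivial h
  comm _ := by
    have key (φ ψ : P ⊞ kernel p ⟶ M.X ())
        (e₀ : biprod.inl ≫ φ = biprod.inl ≫ ψ + h₀ ≫ M.d () ())
        (e₁ : biprod.inr ≫ φ = biprod.inr ≫ ψ + kernel.ι p ≫ h₀ + h₁ ≫ M.d () ()) :
        φ = (biprod.snd ≫ kernel.ι p ≫ biprod.inl) ≫ biprod.desc h₀ h₁ +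
          biprod.desc h₀ h₁ ≫ M.d () () + ψ := by
      apply biprod.hom_ext'
      · simp [e₀, add_comm]
      · simp only [e₁, Category.assoc, Preadditive.comp_add, biprod.inr_snd_assoc,
          biprod.inl_desc, biprod.inr_desc_assoc]
        abel
    exact key _ _ e₀ e₁

end Fold

section Tautological

variable {A : Type u} [Category.{v} A] [Abelian A]

namespace ResolvedMap

variable {X : A} {M : OnePeriodic A}

/-- The morphism of complexes underlying a resolved map. -/
abbrev desc (D : ResolvedMap X M) : foldC D.p ⟶ M := foldDesc D.p D.a D.b D.ha D.hb

variable (X) in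
/-- The resolved map presenting the identity. -/
@[simps]
def id : ResolvedMap X (stalkC X) where
  P := X
  p := 𝟙 X
  a := 𝟙 X
  b := 0
  ha := comp_zero
  hb := (kernel.condition (𝟙 X)).trans zero_comp.symm

/-- The resolved map given by the inclusions in `foldC p`. -/
@[simps]
def tautological {P : A} (p : P ⟶ X) [Epi p] : ResolvedMap X (foldC p) where
  P := P
  p := p
  a := biprod.inl
  b := biprod.inr
  ha := (biprod.inl_snd_assoc _).trans zero_comp
  hb := (biprod.inr_snd_assoc _).symm

lemma tautological_postcomp_foldAug {P : A} (p : P ⟶ X) [Epi p] :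
    ((tautological p).postcomp (foldAug p)).Equiv (id X) := by
  refine ⟨P, p, inferInstance, 𝟙 P, Category.id_comp p, p, Category.comp_id p, 0, 0, ?_, ?_⟩
  · rw [zero_comp, add_zero]
    change 𝟙 P ≫ biprod.inl ≫ biprod.fst ≫ p = p ≫ 𝟙 X
    simp
  · rw [comp_zero, zero_comp, add_zero, add_zero]
    change kernelMap (𝟙 P) (Category.id_comp p) ≫ biprod.inr ≫ biprod.fst ≫ p =
      kernelMap p (Category.comp_id p) ≫ (0 : kernel (𝟙 X) ⟶ X)
    simp

lemma mk_eq_mk {P : A} {p : P ⟶ X} [Epi p] {a a' : P ⟶ M.X ()} {b b' : kernel p ⟶ M.X ()}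
    (h : a = a') (h' : b = b') (ha hb ha' hb') :
    (⟨p, a, b, ha, hb⟩ : ResolvedMap X M) = ⟨p, a', b', ha', hb'⟩ := by
  subst h h'
  rfl

lemma tautological_postcomp_desc (D : ResolvedMap X M) :
    (tautological D.p).postcomp D.desc = D :=
  mk_eq_mk (biprod.inl_desc _ _) (biprod.inr_desc _ _) _ _ _ _

end ResolvedMap

end Tautological

section DerivedCategoryHom

variable {A : Type u} [Category.{v} A] [Abelian A]
  [MorphismProperty.HasLocalization.{w'} (HomologicalComplex.quasiIso A oneShape)]

lemma QD_map_eq_of_homotopy {M N : OnePeriodic A} {f g : M ⟶ N} (h : Homotopy f g) :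
    (QD (A := A)).map f = QD.map g := by
  have := ComplexShape.QFactorsThroughHomotopy_of_exists_prev (c := oneShape)
    (fun _ ↦ ⟨(), trivial⟩) A
  exact HomologicalComplexUpToQuasiIso.Q_map_eq_of_homotopy h

instance {P X : A} (p : P ⟶ X) [Epi p] : IsIso ((QD (A := A)).map (foldAug p)) :=
  (HomologicalComplexUpToQuasiIso.isIso_Q_map_iff_mem_quasiIso _).2 (quasiIso_foldAug p)

namespace ResolvedMap

variable {X : A} {M N : OnePeriodic A}

/-- The morphism in the derived category presented by a resolved map. -/
def toHom (D : ResolvedMap X M) : (QD (A := A)).obj (stalkC X) ⟶ QD.obj M :=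
  inv (QD.map (foldAug D.p)) ≫ QD.map D.desc

lemma toHom_eq_inv_comp (D : ResolvedMap X M) {R : A} {r : R ⟶ X} [Epi r] (u : R ⟶ D.P)
    (hu : u ≫ D.p = r) :
    D.toHom = inv (QD.map (foldAug r)) ≫ QD.map (foldMap u hu ≫ D.desc) := by
  rw [IsIso.eq_inv_comp, ← foldMap_foldAug u hu, Functor.map_comp, Functor.map_comp,
    Category.assoc, toHom, IsIso.hom_inv_id_assoc]

lemma Equiv.toHom_eq {D D' : ResolvedMap X M} (h : D.Equiv D') : D.toHom = D'.toHom := by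
  obtain ⟨R, r, _, u, hu, v, hv, h₀, h₁, e₀, e₁⟩ := h
  rw [toHom_eq_inv_comp D u hu, toHom_eq_inv_comp D' v hv]
  congr 1
  refine QD_map_eq_of_homotopy (foldHomotopy r _ _ h₀ h₁ ?_ ?_)
  · change biprod.inl ≫ biprod.map u (kernelMap u hu) ≫ biprod.desc D.a D.b =
      biprod.inl ≫ biprod.map v (kernelMap v hv) ≫ biprod.desc D'.a D'.b + h₀ ≫ M.d () ()
    simpa using e₀
  · change biprod.inr ≫ biprod.map u (kernelMap u hu) ≫ biprod.desc D.a D.b =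
      biprod.inr ≫ biprod.map v (kernelMap v hv) ≫ biprod.desc D'.a D'.b +
        kernel.ι r ≫ h₀ + h₁ ≫ M.d () ()
    simpa using e₁

lemma postcomp_toHom (D : ResolvedMap X M) (f : M ⟶ N) :
    (D.postcomp f).toHom = D.toHom ≫ QD.map f := by
  have : (D.postcomp f).desc = (D.desc ≫ f : foldC D.p ⟶ N) := by
    ext
    change biprod.desc (D.a ≫ f.f ()) (D.b ≫ f.f ()) = biprod.desc D.a D.b ≫ f.f ()
    apply biprod.hom_ext' <;> simp
  refine (congrArg (inv (QD.map (foldAug D.p)) ≫ ·) ?_).trans (Category.assoc _ _ _).symm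
  exact (congrArg (QD (A := A)).map this).trans (Functor.map_comp _ _ _)

/-- The map from equivalence classes of resolved maps to morphisms in the derived category. -/
def clsToHom (X : A) (M : OnePeriodic A) :
    Cls X M → ((QD (A := A)).obj (stalkC X) ⟶ QD.obj M) :=
  Quotient.lift (s := setoid X M) toHom fun _ _ h ↦ Equiv.toHom_eq h

lemma id_toHom : (id X).toHom = 𝟙 ((QD (A := A)).obj (stalkC X)) := by
  have : (id X).desc = foldAug (𝟙 X) := by
    ext
    change biprod.desc (𝟙 X) (0 : kernel (𝟙 X) ⟶ X) = biprod.fst ≫ 𝟙 X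
    apply biprod.hom_ext' <;> simp
  rw [toHom, this]
  exact IsIso.inv_hom_id _

lemma clsToHom_bijective [HasExt.{w} A]
    (hHered : ∀ X Y : A, Subsingleton (Abelian.Ext.{w} X Y 2)) (X : A) (M : OnePeriodic A) :
    Function.Bijective (clsToHom.{w'} X M) := by
  refine bijective_of_isInvertedBy QD (HomologicalComplex.quasiIso A oneShape) (functor X)
    (fun M N s hs ↦ isIso_functor_map hHered s hs) (id X).cls (clsToHom X) ?_ id_toHom ?_ M
  · intro M N f x
    obtain ⟨D, rfl⟩ := exists_cls_eq x
    exact postcomp_toHom D f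
  · intro M x
    obtain ⟨D, rfl⟩ := exists_cls_eq x
    refine ⟨foldC D.p, (tautological D.p).cls, foldAug D.p, D.desc,
      cls_eq_iff.2 (tautological_postcomp_foldAug D.p),
      congrArg cls (tautological_postcomp_desc D), ?_⟩
    exact IsIso.hom_inv_id_assoc _ _

end ResolvedMap

end DerivedCategoryHom

section StalkTarget

open Abelian

variable {A : Type u} [Category.{v} A] [Abelian A]

namespace ResolvedMap

variable {X Y : A}

lemma ι_comp_a (D : ResolvedMap X (stalkC Y)) : kernel.ι D.p ≫ D.a = 0 :=
  D.hb.trans comp_zero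

/-- The morphism in `A` given by a resolved map to a stalk complex. -/
def toMap (D : ResolvedMap X (stalkC Y)) : X ⟶ Y :=
  (ShortComplex.exact_kernel D.p).desc D.a D.ι_comp_a

lemma p_toMap (D : ResolvedMap X (stalkC Y)) : D.p ≫ D.toMap = D.a :=
  (ShortComplex.exact_kernel D.p).g_desc D.a D.ι_comp_a

lemma Equiv.toMap_eq {D D' : ResolvedMap X (stalkC Y)} (h : D.Equiv D') :
    D.toMap = D'.toMap := by
  obtain ⟨R, r, _, u, hu, v, hv, h₀, h₁, e₀, e₁⟩ := h
  have e : u ≫ D.a = v ≫ D'.a := e₀.trans ((congrArg _ comp_zero).trans (add_zero _))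
  rw [← p_toMap, ← p_toMap] at e
  have key (f g : X ⟶ Y) (e : u ≫ D.p ≫ f = v ≫ D'.p ≫ g) : f = g := by
    rw [← cancel_epi r]
    nth_rw 1 [← hu]
    rw [← hv, Category.assoc, Category.assoc, e]
  exact key _ _ e

variable [HasExt.{w} A]

/-- The extension class of a resolved map to a stalk complex. -/
def toExt (D : ResolvedMap X (stalkC Y)) : Ext.{w} X Y 1 :=
  (kernelSequence_shortExact D.p).extClass.comp (Ext.mk₀ (Y := Y) D.b) (add_zero 1)

lemma toExt_eq (D : ResolvedMap X (stalkC Y)) {R : A} {r : R ⟶ X} [Epi r] (u : R ⟶ D.P)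
    (hu : u ≫ D.p = r) :
    D.toExt = (kernelSequence_shortExact r).extClass.comp
      (Ext.mk₀ (Y := Y) (kernelMap u hu ≫ D.b)) (add_zero 1) := by
  rw [toExt, ← extClass_kernelMap u hu]
  refine (Ext.comp_assoc_of_third_deg_zero _ _ _ _).trans (congrArg (Ext.comp _ · _) ?_)
  exact Ext.mk₀_comp_mk₀ _ _

lemma Equiv.toExt_eq {D D' : ResolvedMap X (stalkC Y)} (h : D.Equiv D') :
    D.toExt = D'.toExt := by
  obtain ⟨R, r, _, u, hu, v, hv, h₀, h₁, e₀, e₁⟩ := h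
  rw [ResolvedMap.toExt_eq D u hu, ResolvedMap.toExt_eq D' v hv]
  have key (b b' : kernel r ⟶ Y) (h₀ : R ⟶ Y) (e : b = b' + kernel.ι r ≫ h₀) :
      (kernelSequence_shortExact r).extClass.comp (Ext.mk₀ b) (add_zero 1) =
        (kernelSequence_shortExact r).extClass.comp (Ext.mk₀ b') (add_zero 1) := by
    rw [e, Ext.mk₀_add, Ext.comp_add, extClass_comp_mk₀_kernel_ι_comp, add_zero]
  exact key _ _ h₀ (e₁.trans ((congrArg _ comp_zero).trans (add_zero _)))

lemma equiv_of_stalk {D D' : ResolvedMap X (stalkC Y)} (h : D.toMap = D'.toMap)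
    (h' : D.toExt = D'.toExt) : D.Equiv D' := by
  let u := pullback.fst D.p D'.p
  let v := pullback.snd D.p D'.p
  have hv : v ≫ D'.p = u ≫ D.p := pullback.condition.symm
  rw [toExt_eq D u rfl, toExt_eq D' v hv] at h'
  have key (b b' : kernel (u ≫ D.p) ⟶ Y)
      (e : (kernelSequence_shortExact (u ≫ D.p)).extClass.comp (Ext.mk₀ b) (add_zero 1) =
        (kernelSequence_shortExact (u ≫ D.p)).extClass.comp (Ext.mk₀ b') (add_zero 1)) :
      ∃ h₀, b = b' + kernel.ι (u ≫ D.p) ≫ h₀ := by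
    obtain ⟨x, hx⟩ := Ext.contravariant_sequence_exact₁ (kernelSequence_shortExact (u ≫ D.p)) _
      (Ext.mk₀ b - Ext.mk₀ b') (add_zero 1)
      (by rw [sub_eq_add_neg, Ext.comp_add, Ext.comp_neg, e, add_neg_cancel])
    obtain ⟨h₀, rfl⟩ := (Ext.mk₀_bijective _ _).2 x
    refine ⟨h₀, (Ext.mk₀_bijective _ _).1 ?_⟩
    rw [Ext.mk₀_add, ← Ext.mk₀_comp_mk₀]
    exact (sub_eq_iff_eq_add'.1 hx.symm)
  obtain ⟨h₀, e⟩ := key _ _ h'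
  refine ⟨_, u ≫ D.p, inferInstance, u, rfl, v, hv, h₀, 0, ?_, ?_⟩
  · refine Eq.trans ?_ ((congrArg _ comp_zero).trans (add_zero _)).symm
    rw [← p_toMap, ← p_toMap, h]
    have key (f : X ⟶ Y) : u ≫ D.p ≫ f = v ≫ D'.p ≫ f := by
      rw [← Category.assoc, ← Category.assoc, hv]
    exact key _
  · rw [zero_comp, add_zero]
    exact e

lemma exists_toMap_toExt (f : X ⟶ Y) (ξ : Ext.{w} X Y 1) :
    ∃ D : ResolvedMap X (stalkC Y), D.toMap = f ∧ D.toExt = ξ := by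
  obtain ⟨P, p, _, h⟩ := exists_epi_mk₀_comp_eq_zero ξ
  obtain ⟨x, hx⟩ := Ext.contravariant_sequence_exact₃ (kernelSequence_shortExact p) _ ξ h
    (add_zero 1)
  obtain ⟨b, rfl⟩ := (Ext.mk₀_bijective _ _).2 x
  let D : ResolvedMap X (stalkC Y) :=
    { p := p
      a := p ≫ f
      b := b
      ha := comp_zero
      hb := (kernel.condition_assoc p f).trans (zero_comp.trans comp_zero.symm) }
  exact ⟨D, (cancel_epi p).1 D.p_toMap, hx⟩

variable (X Y) in
/-- Resolved maps to a stalk complex are classified by morphisms and extensions in `A`. -/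
def clsStalkEquiv : Cls X (stalkC Y) ≃ (X ⟶ Y) × Ext.{w} X Y 1 :=
  Equiv.ofBijective
    (Quotient.lift (s := setoid X (stalkC Y)) (fun D ↦ (D.toMap, D.toExt))
      fun _ _ h ↦ Prod.ext (Equiv.toMap_eq h) (Equiv.toExt_eq h)) (by
    constructor
    · intro x y h
      obtain ⟨D, rfl⟩ := exists_cls_eq x
      obtain ⟨D', rfl⟩ := exists_cls_eq y
      exact cls_eq_iff.2 (equiv_of_stalk (Prod.ext_iff.1 h).1 (Prod.ext_iff.1 h).2)
    · rintro ⟨f, ξ⟩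
      obtain ⟨D, rfl, rfl⟩ := exists_toMap_toExt f ξ
      exact ⟨D.cls, rfl⟩)

end ResolvedMap

end StalkTarget

section StalkFunctor

variable {A : Type u} [Category.{v} A] [Abelian A]

variable (A) in
/-- The functor sending an object to its stalk complex. -/
abbrev stalkFunctor : A ⥤ OnePeriodic A where
  obj := stalkC
  map := stalkHom
  map_id _ := rfl
  map_comp _ _ := rfl

instance : (stalkFunctor A).Additive where

/-- Evaluating stalk complexes gives back the identity functor. -/
def stalkFunctorCompEval (i : Unit) :
    𝟭 A ≅ stalkFunctor A ⋙ HomologicalComplex.eval A oneShape i := Iso.refl (𝟭 A)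

instance : PreservesFiniteLimits (stalkFunctor A) where
  preservesFiniteLimits _ _ _ :=
    HomologicalComplex.preservesLimitsOfShape_of_eval _ fun i ↦
      preservesLimitsOfShape_of_natIso (stalkFunctorCompEval i)

instance : PreservesFiniteColimits (stalkFunctor A) where
  preservesFiniteColimits _ _ _ :=
    HomologicalComplex.preservesColimitsOfShape_of_eval _ fun i ↦
      preservesColimitsOfShape_of_natIso (stalkFunctorCompEval i)

end StalkFunctor

section FoldSequence

variable {A : Type u} [Category.{v} A] [Abelian A]

/-- The morphism from `KC P` to a complex `M` determined by a morphism from `P`. -/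
def freeDesc {P : A} {M : OnePeriodic A} (m : P ⟶ M.X ()) : KC P ⟶ M where
  f _ := biprod.desc (m ≫ M.d () ()) m
  comm' := by
    intros
    apply biprod.hom_ext' <;> simp [KC]

/-- The projection of `foldC p` onto the stalk complex of `ker p`. -/
def foldSnd {P X : A} (p : P ⟶ X) : foldC p ⟶ stalkC (kernel p) where
  f _ := biprod.snd
  comm' := by intros; simp [foldC, stalkC]

/-- The inclusion of `foldC p` in `KC P`. -/
def foldInclusion {P X : A} (p : P ⟶ X) : foldC p ⟶ KC P where
  f _ := biprod.map (𝟙 P) (kernel.ι p)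
  comm' := by
    intros
    apply biprod.hom_ext' <;> simp [foldC, KC]

/-- The morphism `KC P ⟶ stalkC X` induced by `p : P ⟶ X`. -/
def freeAug {P X : A} (p : P ⟶ X) : KC P ⟶ stalkC X where
  f _ := biprod.snd ≫ p
  comm' := by intros; simp [KC, stalkC]

/-- The sequence of complexes `0 ⟶ foldC p ⟶ KC P ⟶ stalkC X ⟶ 0`. -/
abbrev foldSequence {P X : A} (p : P ⟶ X) : ShortComplex (OnePeriodic A) where
  f := foldInclusion p
  g := freeAug p
  zero := by
    ext
    change biprod.map (𝟙 P) (kernel.ι p) ≫ biprod.snd ≫ p = 0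
    simp

lemma foldSequence_shortExact {P X : A} (p : P ⟶ X) [Epi p] : (foldSequence p).ShortExact := by
  apply HomologicalComplex.shortExact_of_degreewise_shortExact
  intro _
  have w : biprod.map (𝟙 P) (kernel.ι p) ≫ biprod.snd ≫ p = 0 := by simp
  have hm : Mono (biprod.map (𝟙 P) (kernel.ι p)) := inferInstance
  have : (ShortComplex.mk _ _ w).ShortExact :=
    { mono_f := hm
      epi_g := epi_comp _ _
      exact := by
        refine ShortComplex.exact_of_f_is_kernel _ (KernelFork.IsLimit.ofι' _ w fun k hk ↦
          ⟨biprod.lift (k ≫ biprod.fst) (kernel.lift p (k ≫ biprod.snd) (by simpa using hk)), ?_⟩)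
        apply biprod.hom_ext <;> simp }
  exact this

lemma exists_eq_foldAug_comp_add {P X Y : A} (p : P ⟶ X) [Epi p] (t : foldC p ⟶ stalkC Y) :
    ∃ (f : X ⟶ Y) (b : kernel p ⟶ Y),
      t = foldAug p ≫ (stalkFunctor A).map f + foldSnd p ≫ (stalkFunctor A).map b := by
  have key (t : P ⊞ kernel p ⟶ Y)
      (ht : t ≫ 0 = (biprod.snd ≫ kernel.ι p ≫ biprod.inl) ≫ t) :
      ∃ (f : X ⟶ Y) (b : kernel p ⟶ Y),
        t = (biprod.fst ≫ p) ≫ f + biprod.snd ≫ b := by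
    have h : kernel.ι p ≫ biprod.inl ≫ t = 0 := by
      rw [← cancel_epi (biprod.snd : P ⊞ kernel p ⟶ _), comp_zero, ← comp_zero (f := t), ht]
      simp
    refine ⟨(ShortComplex.exact_kernel p).desc _ h, biprod.inr ≫ t, ?_⟩
    have h' : p ≫ (ShortComplex.exact_kernel p).desc _ h = biprod.inl ≫ t :=
      (ShortComplex.exact_kernel p).g_desc _ h
    rw [Category.assoc, h']
    apply biprod.hom_ext' <;> simp
  obtain ⟨f, b, h⟩ := key (t.f ()) (t.comm () ())
  refine ⟨f, b, ?_⟩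
  ext
  exact h

lemma inl_comp_freeHom {P Y : A} (g : KC P ⟶ stalkC Y) :
    (biprod.inl ≫ g.f () : P ⟶ Y) = 0 := by
  have key (g : P ⊞ P ⟶ Y) (hg : g ≫ 0 = (biprod.snd ≫ biprod.inl) ≫ g) :
      biprod.inl ≫ g = 0 := by
    rw [← cancel_epi (biprod.snd : P ⊞ P ⟶ _), comp_zero, ← comp_zero (f := g), hg,
      Category.assoc]
  exact key _ (g.comm () ())

open Abelian

variable [HasExt.{w''} (OnePeriodic A)]

lemma extClass_foldMap {P P' X : A} {p : P ⟶ X} {p' : P' ⟶ X} [Epi p] [Epi p'] (f : P' ⟶ P)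
    (hf : f ≫ p = p') :
    (foldSequence_shortExact p').extClass.comp (Ext.mk₀ (foldMap f hf)) (add_zero 1) =
      (foldSequence_shortExact p).extClass := by
  let φ : foldSequence p' ⟶ foldSequence p :=
    { τ₁ := foldMap f hf
      τ₂ := freeDesc (M := KC P) (f ≫ biprod.inr)
      τ₃ := 𝟙 _
      comm₁₂ := by
        ext
        change biprod.map f (kernelMap f hf) ≫ biprod.map (𝟙 P) (kernel.ι p) =
          biprod.map (𝟙 P') (kernel.ι p') ≫
            biprod.desc ((f ≫ biprod.inr) ≫ biprod.snd ≫ biprod.inl) (f ≫ biprod.inr)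
        apply biprod.hom_ext' <;> simp
      comm₂₃ := by
        ext
        change biprod.desc ((f ≫ biprod.inr) ≫ biprod.snd ≫ biprod.inl) (f ≫ biprod.inr) ≫
          biprod.snd ≫ p = (biprod.snd ≫ p') ≫ 𝟙 X
        apply biprod.hom_ext' <;> simp [hf] }
  exact (ShortComplex.ShortExact.extClass_naturality _ (foldSequence_shortExact p) φ).trans
    (Ext.mk₀_id_comp _)

lemma extClass_foldSnd [HasExt.{w} A] {P X : A} (p : P ⟶ X) [Epi p] :
    (foldSequence_shortExact p).extClass.comp (Ext.mk₀ (foldSnd p)) (add_zero 1) =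
      (kernelSequence_shortExact p).extClass.mapExactFunctor (stalkFunctor A) := by
  rw [Ext.mapExactFunctor_extClass]
  let φ : foldSequence p ⟶ (kernelSequence p).map (stalkFunctor A) :=
    { τ₁ := foldSnd p
      τ₂ := freeAug (𝟙 P)
      τ₃ := 𝟙 _
      comm₁₂ := by
        ext
        change biprod.snd ≫ kernel.ι p = biprod.map (𝟙 P) (kernel.ι p) ≫ biprod.snd ≫ 𝟙 P
        simp
      comm₂₃ := by
        ext
        change (biprod.snd ≫ 𝟙 P) ≫ p = (biprod.snd ≫ p) ≫ 𝟙 X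
        simp }
  exact (ShortComplex.ShortExact.extClass_naturality _
    ((kernelSequence_shortExact p).map_of_exact (stalkFunctor A)) φ).trans (Ext.mk₀_id_comp _)

/-- The class in `Ext¹` of stalk complexes given by a morphism `f : X ⟶ Y`: the pushout along `f`
of the extension `KC X` of `stalkC X` by itself. -/
def stalkExtOfHom (X Y : A) : (X ⟶ Y) →+ Ext.{w''} (stalkC X) (stalkC Y) 1 where
  toFun f := (foldSequence_shortExact (𝟙 X)).extClass.comp
    (Ext.mk₀ (foldAug (𝟙 X) ≫ (stalkFunctor A).map f)) (add_zero 1)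
  map_zero' := by rw [Functor.map_zero, comp_zero, Ext.mk₀_zero, Ext.comp_zero]
  map_add' f g := by
    rw [Functor.map_add, Preadditive.comp_add, Ext.mk₀_add, Ext.comp_add]

lemma extClass_foldAug {P X Y : A} (p : P ⟶ X) [Epi p] (f : X ⟶ Y) :
    (foldSequence_shortExact p).extClass.comp
      (Ext.mk₀ (foldAug p ≫ (stalkFunctor A).map f)) (add_zero 1) = stalkExtOfHom X Y f := by
  rw [← foldMap_foldAug p (Category.comp_id p), Category.assoc, ← Ext.mk₀_comp_mk₀,
    ← Ext.comp_assoc_of_second_deg_zero, extClass_foldMap]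
  rfl

/-- The comparison map from morphisms and extensions in `A` to extensions of stalk complexes. -/
def stalkExtMap [HasExt.{w} A] (X Y : A) :
    (X ⟶ Y) × Ext.{w} X Y 1 →+ Ext.{w''} (stalkC X) (stalkC Y) 1 :=
  (stalkExtOfHom X Y).coprod ((stalkFunctor A).mapExtAddHom X Y 1)

lemma stalkExtMap_extClass_comp [HasExt.{w} A] {P X Y : A} (p : P ⟶ X) [Epi p] (f : X ⟶ Y)
    (b : kernel p ⟶ Y) :
    stalkExtMap X Y
        (f, (kernelSequence_shortExact p).extClass.comp (Ext.mk₀ b) (add_zero 1)) =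
      (foldSequence_shortExact p).extClass.comp (Ext.mk₀
        (foldAug p ≫ (stalkFunctor A).map f + foldSnd p ≫ (stalkFunctor A).map b))
        (add_zero 1) := by
  rw [Ext.mk₀_add, Ext.comp_add, extClass_foldAug, ← Ext.mk₀_comp_mk₀ (foldSnd p),
    ← Ext.comp_assoc_of_second_deg_zero, extClass_foldSnd, ← Ext.mapExactFunctor_mk₀,
    ← Ext.mapExactFunctor_comp]
  rfl

lemma stalkExtMap_bijective [HasExt.{w} A] (X Y : A) :
    Function.Bijective (stalkExtMap.{w, w''} X Y) := by
  constructor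
  · rw [injective_iff_map_eq_zero]
    rintro ⟨f, ξ⟩ h
    obtain ⟨P, p, _, hp⟩ := exists_epi_mk₀_comp_eq_zero ξ
    obtain ⟨x, rfl⟩ := Ext.contravariant_sequence_exact₃ (kernelSequence_shortExact p) _ ξ hp
      (add_zero 1)
    obtain ⟨b, rfl⟩ := (Ext.mk₀_bijective _ _).2 x
    replace h := (stalkExtMap_extClass_comp p f b).symm.trans h
    obtain ⟨y, hy⟩ := Ext.contravariant_sequence_exact₁ (foldSequence_shortExact p) _ _ _ h
    obtain ⟨g, rfl⟩ := (Ext.mk₀_bijective _ _).2 y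
    rw [Ext.mk₀_comp_mk₀] at hy
    have hg := congrArg (fun t : foldC p ⟶ stalkC Y ↦ t.f ()) ((Ext.mk₀_bijective _ _).1 hy)
    have key (g : P ⊞ P ⟶ Y) (hg₀ : biprod.inl ≫ g = 0)
        (hg : biprod.map (𝟙 P) (kernel.ι p) ≫ g = (biprod.fst ≫ p) ≫ f + biprod.snd ≫ b) :
        f = 0 ∧ b = kernel.ι p ≫ biprod.inr ≫ g := by
      constructor
      · rw [← cancel_epi p, comp_zero, ← hg₀]
        simpa using (biprod.inl ≫= hg).symm
      · simpa using (biprod.inr ≫= hg).symm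
    obtain ⟨rfl, rfl⟩ := key _ (inl_comp_freeHom g) hg
    exact Prod.ext rfl (extClass_comp_mk₀_kernel_ι_comp p _)
  · intro z
    obtain ⟨G, q, _, hq⟩ := exists_epi_mk₀_comp_eq_zero z
    let p : G.X () ⟶ X := q.f ()
    have : Epi p := inferInstanceAs (Epi ((HomologicalComplex.eval A oneShape ()).map q))
    have hp : freeDesc (𝟙 (G.X ())) ≫ q = freeAug p := by
      ext
      have key (p : G.X () ⟶ X) (hp : p ≫ 0 = G.d () () ≫ p) :
          biprod.desc (𝟙 (G.X ()) ≫ G.d () ()) (𝟙 (G.X ())) ≫ p = biprod.snd ≫ p := by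
        apply biprod.hom_ext' <;> simp [← hp]
      exact key p (q.comm () ())
    have h : (Ext.mk₀ (freeAug p)).comp z (zero_add 1) = 0 := by
      rw [← hp, ← Ext.mk₀_comp_mk₀_assoc, hq, Ext.comp_zero]
    obtain ⟨y, rfl⟩ := Ext.contravariant_sequence_exact₃ (foldSequence_shortExact p) _ z h
      (add_zero 1)
    obtain ⟨t, rfl⟩ := (Ext.mk₀_bijective _ _).2 y
    obtain ⟨f, b, rfl⟩ := exists_eq_foldAug_comp_add p t
    exact ⟨_, stalkExtMap_extClass_comp p f b⟩

end FoldSequence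

/-- **Statement 3** (Lemma 3.1(1)): for stalk complexes,
`Ext¹_{C₁(A)}(A,B) ≅ Hom_{D₁(A)}(A,B) ≅ Hom_A(A,B) ⊕ Ext¹_A(A,B)`. -/
theorem ext_hom_in_one_periodic_derived_category
    (k : Type) [Field k] [Fintype k]
    {A : Type u} [Category.{v} A] [Abelian A] [Linear k A] [EssentiallySmall.{v} A]
    [HasExt.{w} A] [HasExt.{w''} (OnePeriodic A)] [∀ X Y : A, Finite (X ⟶ Y)]
    (hExtFin : ∀ X Y : A, Finite (Abelian.Ext X Y 1))
    (hHered : ∀ X Y : A, Subsingleton (Abelian.Ext X Y 2))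
    [MorphismProperty.HasLocalization.{w'} (HomologicalComplex.quasiIso A oneShape)]
    (X Y : A) :
    Nonempty (Abelian.Ext (stalkC X) (stalkC Y) 1 ≃ (QD.obj (stalkC X) ⟶ QD.obj (stalkC Y))) ∧
    Nonempty ((QD.obj (stalkC X) ⟶ QD.obj (stalkC Y)) ≃ ((X ⟶ Y) × Abelian.Ext X Y 1)) ∧
    Nonempty (Abelian.Ext (stalkC X) (stalkC Y) 1 ≃+ ((X ⟶ Y) × Abelian.Ext X Y 1)) := by
  have e₁ := (Equiv.ofBijective _ (ResolvedMap.clsToHom_bijective hHered X (stalkC Y))).symm.trans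
    (ResolvedMap.clsStalkEquiv X Y)
  have e₂ := (AddEquiv.ofBijective _ (stalkExtMap_bijective X Y)).symm
  exact ⟨⟨e₂.toEquiv.trans e₁.symm⟩, ⟨e₁⟩, ⟨e₂⟩⟩

end
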